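/- arXiv:2002.10503 — 2 statements merged into one kernel-verified Lean document; each statement's English description precedes it below -/
import Mathlib

section
/- Fix n ≥ 2, w ∈ S_n, and k ∈ {1,…,n−1}. If w has a 321-pattern that straddles k in both position and value (i.e., positions i1<i2<i3 with w(i1)>w(i2)>w(i3), i1 ≤ k < i3, and w(i3) ≤ k < w(i1)), then max_k(w) ≥ 2. -/
/-- The simple reflection `σ_i = (i, i+1)`, acting on `ℕ` (1-indexed positions/values). -/
def simpleRefl (i : ℕ) : Equiv.Perm ℕ := Equiv.swap i (i + 1)

/-- `w` is a permutation of `{1, …, n}`: it fixes every point outside `[1, n]`. -/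
def IsPermOf (n : ℕ) (w : Equiv.Perm ℕ) : Prop :=
  ∀ x : ℕ, x ∉ Finset.Icc 1 n → w x = x

/-- The Coxeter length of `w`: its number of inversions on `{1, …, n}`. -/
def len (n : ℕ) (w : Equiv.Perm ℕ) : ℕ :=
  ((Finset.Icc 1 n ×ˢ Finset.Icc 1 n).filter fun p => p.1 < p.2 ∧ w p.2 < w p.1).card

/-- `L` is a word for `w`: a list of indices in `[1, n-1]` whose associated product of
simple reflections (read left to right) is `w`. -/
def IsWord (n : ℕ) (w : Equiv.Perm ℕ) (L : List ℕ) : Prop :=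
  (∀ i ∈ L, 1 ≤ i ∧ i ≤ n - 1) ∧ (L.map simpleRefl).prod = w

/-- `L` is a reduced decomposition of `w`. -/
def IsReducedWord (n : ℕ) (w : Equiv.Perm ℕ) (L : List ℕ) : Prop :=
  IsWord n w L ∧ L.length = len n w

/-- `min_k(w)`: the minimum number of occurrences of `σ_k` in a reduced decomposition of `w`. -/
noncomputable def minOcc (n k : ℕ) (w : Equiv.Perm ℕ) : ℕ :=
  sInf {m | ∃ L : List ℕ, IsReducedWord n w L ∧ L.count k = m}

/-- `max_k(w)`: the maximum number of occurrences of `σ_k` in a reduced decomposition of `w`. -/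
noncomputable def maxOcc (n k : ℕ) (w : Equiv.Perm ℕ) : ℕ :=
  sSup {m | ∃ L : List ℕ, IsReducedWord n w L ∧ L.count k = m}

/-- `expat_k(w) = |{w(1),…,w(k)} ∩ {k+1,…,n}|`. -/
def expat (n k : ℕ) (w : Equiv.Perm ℕ) : ℕ :=
  (((Finset.Icc 1 k).image fun i => w i) ∩ Finset.Icc (k + 1) n).card

/-- A `321`-pattern of `w` in positions `i1 < i2 < i3` (within `[1, n]`). -/
def Is321At (n : ℕ) (w : Equiv.Perm ℕ) (i1 i2 i3 : ℕ) : Prop :=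
  1 ≤ i1 ∧ i1 < i2 ∧ i2 < i3 ∧ i3 ≤ n ∧ w i3 < w i2 ∧ w i2 < w i1

/-- A `3412`-pattern of `w` in positions `i1 < i2 < i3 < i4` (within `[1, n]`). -/
def Is3412At (n : ℕ) (w : Equiv.Perm ℕ) (i1 i2 i3 i4 : ℕ) : Prop :=
  1 ≤ i1 ∧ i1 < i2 ∧ i2 < i3 ∧ i3 < i4 ∧ i4 ≤ n ∧
    w i3 < w i4 ∧ w i4 < w i1 ∧ w i1 < w i2

/-- `p` is a position pair at `k`: `p = (i1, i3)` for a `321`-pattern with `i1 ≤ k < i3`,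
or `p = (i2, i3)` for a `3412`-pattern with `i2 ≤ k < i3`. -/
def IsPosPair (n k : ℕ) (w : Equiv.Perm ℕ) (p : ℕ × ℕ) : Prop :=
  (∃ i2, Is321At n w p.1 i2 p.2 ∧ p.1 ≤ k ∧ k < p.2) ∨
  (∃ i1 i4, Is3412At n w i1 p.1 p.2 i4 ∧ p.1 ≤ k ∧ k < p.2)

/-- `p` is a value pair at `k`: `p = (j3, j1)` for a `321`-pattern with values
`j1 < j2 < j3` and `j1 ≤ k < j3`, or `p = (j4, j1)` for a `3412`-pattern with values
`j1 < j2 < j3 < j4` and `j2 ≤ k < j3`. -/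
def IsValPair (n k : ℕ) (w : Equiv.Perm ℕ) (p : ℕ × ℕ) : Prop :=
  (∃ i1 i2 i3, Is321At n w i1 i2 i3 ∧ w i3 ≤ k ∧ k < w i1 ∧ p = (w i1, w i3)) ∨
  (∃ i1 i2 i3 i4, Is3412At n w i1 i2 i3 i4 ∧ w i4 ≤ k ∧ k < w i1 ∧ p = (w i2, w i3))

/-- `PosPair_k(w)`: the number of distinct position pairs at `k` in `w`. -/
noncomputable def posPairCount (n k : ℕ) (w : Equiv.Perm ℕ) : ℕ :=
  Set.ncard {p : ℕ × ℕ | IsPosPair n k w p}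

/-- `ValPair_k(w)`: the number of distinct value pairs at `k` in `w`. -/
noncomputable def valPairCount (n k : ℕ) (w : Equiv.Perm ℕ) : ℕ :=
  Set.ncard {p : ℕ × ℕ | IsValPair n k w p}

theorem sr_invol (i x : ℕ) : simpleRefl i (simpleRefl i x) = x := by
  simp [simpleRefl]

theorem sr_mul_self (i : ℕ) : simpleRefl i * simpleRefl i = 1 := by
  simp [simpleRefl]

theorem sr_apply (i x : ℕ) :
    simpleRefl i x = if x = i then i + 1 else if x = i + 1 then i else x := by
  simp [simpleRefl, Equiv.swap_apply_def]

theorem sr_mono (i x y : ℕ) (h : x < y) (hne : ¬ (x = i ∧ y = i + 1)) :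
    simpleRefl i x < simpleRefl i y := by
  rw [sr_apply, sr_apply]; split_ifs <;> omega

theorem sr_mem (n i x : ℕ) (h1 : 1 ≤ i) (h2 : i + 1 ≤ n) (hx : 1 ≤ x ∧ x ≤ n) :
    1 ≤ simpleRefl i x ∧ simpleRefl i x ≤ n := by
  rw [sr_apply]; split_ifs <;> omega

theorem len_step (n : ℕ) (w : Equiv.Perm ℕ) (i : ℕ) (h1 : 1 ≤ i) (h2 : i + 1 ≤ n)
    (hd : w (i + 1) < w i) : len n (w * simpleRefl i) + 1 = len n w := by
  unfold len
  have hi : simpleRefl i i = i + 1 := by simp [simpleRefl]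
  have hi' : simpleRefl i (i + 1) = i := by simp [simpleRefl]
  have hmem : (i, i + 1) ∈ (Finset.Icc 1 n ×ˢ Finset.Icc 1 n).filter
      fun p => p.1 < p.2 ∧ w p.2 < w p.1 := by
    simp; omega
  rw [← Finset.card_erase_add_one hmem]
  congr 1
  apply Finset.card_nbij' (fun p => (simpleRefl i p.1, simpleRefl i p.2))
    (fun p => (simpleRefl i p.1, simpleRefl i p.2))
  · rintro ⟨x, y⟩ h
    rw [Finset.mem_coe, Finset.mem_filter] at h
    simp only [Finset.mem_product, Finset.mem_Icc, Equiv.Perm.mul_apply] at h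
    obtain ⟨⟨hx, hy⟩, hlt, hw⟩ := h
    have hne : ¬ (x = i ∧ y = i + 1) := by
      rintro ⟨rfl, rfl⟩
      rw [hi, hi'] at hw; omega
    simp only [Finset.mem_coe, Finset.mem_erase, Finset.mem_filter, Finset.mem_product, ne_eq,
      Finset.mem_Icc, Prod.mk.injEq]
    refine ⟨?_, ⟨sr_mem n i x h1 h2 hx, sr_mem n i y h1 h2 hy⟩, sr_mono i x y hlt hne, hw⟩
    rintro ⟨ha, hb⟩
    have := congrArg (simpleRefl i) ha
    have := congrArg (simpleRefl i) hb
    simp only [sr_invol, hi, hi'] at *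
    omega
  · rintro ⟨x, y⟩ h
    simp only [Finset.mem_coe, Finset.mem_erase, Finset.mem_filter, Finset.mem_product, ne_eq,
      Finset.mem_Icc, Prod.mk.injEq] at h
    obtain ⟨hne, ⟨hx, hy⟩, hlt, hw⟩ := h
    rw [Finset.mem_coe, Finset.mem_filter]
    simp only [Finset.mem_product, Finset.mem_Icc, Equiv.Perm.mul_apply, sr_invol]
    exact ⟨⟨sr_mem n i x h1 h2 hx, sr_mem n i y h1 h2 hy⟩, sr_mono i x y hlt hne, hw⟩
  · rintro ⟨x, y⟩ _
    simp [sr_invol]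
  · rintro ⟨x, y⟩ _
    simp [sr_invol]

theorem perm_step (n : ℕ) (w : Equiv.Perm ℕ) (hw : IsPermOf n w) (i : ℕ) (h1 : 1 ≤ i)
    (h2 : i + 1 ≤ n) : IsPermOf n (w * simpleRefl i) := by
  intro x hx
  have h := hw x hx
  simp only [Finset.mem_Icc] at hx
  rw [Equiv.Perm.mul_apply, sr_apply, if_neg (by omega), if_neg (by omega), h]

theorem perm_range (n : ℕ) (w : Equiv.Perm ℕ) (hw : IsPermOf n w) (x : ℕ)
    (hx : 1 ≤ x ∧ x ≤ n) : 1 ≤ w x ∧ w x ≤ n := by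
  by_contra h
  have h2 := hw (w x) (by simpa [Finset.mem_Icc] using h)
  have := w.injective h2
  omega

theorem word_step (n : ℕ) (w : Equiv.Perm ℕ) (i : ℕ) (h1 : 1 ≤ i) (h2 : i + 1 ≤ n)
    (hd : w (i + 1) < w i) (L : List ℕ) (hL : IsReducedWord n (w * simpleRefl i) L) :
    IsReducedWord n w (L ++ [i]) := by
  obtain ⟨⟨ha, hb⟩, hc⟩ := hL
  refine ⟨⟨?_, ?_⟩, ?_⟩
  · intro j hj
    rcases List.mem_append.1 hj with h | h
    · exact ha j h
    · simp at h; omega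
  · simp [hb, mul_assoc, sr_mul_self]
  · rw [← len_step n w i h1 h2 hd]; simp [hc]

theorem mono_id (w : Equiv.Perm ℕ) (h : StrictMono w) : w = 1 := by
  have h' : StrictMono w.symm := by
    intro a b hab
    rw [← h.lt_iff_lt]; simpa using hab
  ext x
  have a := h.le_apply (x := x)
  have b := h'.le_apply (x := w x)
  simp at b
  simp; omega

theorem exists_word (n : ℕ) : ∀ (m : ℕ) (w : Equiv.Perm ℕ), IsPermOf n w → len n w = m →
    ∃ L, IsReducedWord n w L := by
  intro m
  induction m with
  | zero =>
    intro w hw hm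
    have hid : w = 1 := by
      apply mono_id
      apply strictMono_nat_of_lt_succ
      intro i
      have hne : w i ≠ w (i + 1) := fun h => by have := w.injective h; omega
      by_contra hlt
      have hd : w (i + 1) < w i := by omega
      by_cases hi : 1 ≤ i ∧ i + 1 ≤ n
      · have := len_step n w i hi.1 hi.2 hd; omega
      · by_cases h0 : i = 0
        · subst h0
          have := hw 0 (by simp); omega
        · have e1 := hw (i + 1) (by simp; omega)
          by_cases h3 : i ≤ n
          · have := perm_range n w hw i (by omega); omega
          · have := hw i (by simp; omega); omega
    exact ⟨[], ⟨by simp, by simp [hid]⟩, by simp [hm]⟩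
  | succ m ih =>
    intro w hw hm
    have : ∃ i, 1 ≤ i ∧ i + 1 ≤ n ∧ w (i + 1) < w i := by
      by_contra hno
      push Not at hno
      have hid : w = 1 := by
        apply mono_id
        apply strictMono_nat_of_lt_succ
        intro i
        have hne : w i ≠ w (i + 1) := fun h => by have := w.injective h; omega
        by_cases hi : 1 ≤ i ∧ i + 1 ≤ n
        · have := hno i hi.1 hi.2; omega
        · by_cases h0 : i = 0
          · subst h0
            have := hw 0 (by simp); omega
          · have e1 := hw (i + 1) (by simp; omega)
            by_cases h3 : i ≤ n
            · have := perm_range n w hw i (by omega); omega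
            · have := hw i (by simp; omega); omega
      subst hid
      have : len n 1 = 0 := by
        unfold len
        rw [Finset.card_eq_zero, Finset.filter_eq_empty_iff]
        rintro ⟨x, y⟩ _ ⟨a, b⟩
        simp at a b; omega
      omega
    obtain ⟨i, h1, h2, hd⟩ := this
    have hs := len_step n w i h1 h2 hd
    obtain ⟨L, hL⟩ := ih _ (perm_step n w hw i h1 h2) (by omega)
    exact ⟨_, word_step n w i h1 h2 hd L hL⟩

theorem word_stab (k : ℕ) (L : List ℕ) (hk : k ∉ L) (x : ℕ) :
    (L.map simpleRefl).prod x ≤ k ↔ x ≤ k := by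
  induction L with
  | nil => simp
  | cons i L ih =>
    simp only [List.mem_cons, not_or] at hk
    rw [← ih hk.2, List.map_cons, List.prod_cons, Equiv.Perm.mul_apply, sr_apply]
    split_ifs <;> omega

theorem inc_le (f : ℕ → ℕ) (a b : ℕ) (hab : a ≤ b)
    (h : ∀ i, a ≤ i → i < b → f i ≤ f (i + 1)) : f a ≤ f b := by
  induction b, hab using Nat.le_induction with
  | base => exact le_rfl
  | succ m hm ih =>
    exact (ih fun i h1 h2 => h i h1 (by omega)).trans (h m hm (by omega))

/-- Final step: descent at `k`, and the result still moves something across `k`. -/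
theorem final_step (n k : ℕ) (w : Equiv.Perm ℕ) (hw : IsPermOf n w) (hk1 : 1 ≤ k)
    (hk2 : k + 1 ≤ n) (hd : w (k + 1) < w k) (x : ℕ) (hx : x ≠ k) (hx' : x ≠ k + 1)
    (hcross : ¬ (w x ≤ k ↔ x ≤ k)) :
    ∃ L, IsReducedWord n w L ∧ 2 ≤ L.count k := by
  obtain ⟨L, hL⟩ := exists_word n _ _ (perm_step n w hw k hk1 hk2) rfl
  refine ⟨_, word_step n w k hk1 hk2 hd L hL, ?_⟩
  have hmem : k ∈ L := by
    by_contra hk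
    have h := word_stab k L hk x
    rw [hL.1.2, Equiv.Perm.mul_apply, sr_apply, if_neg hx, if_neg hx'] at h
    exact hcross h
  have := List.count_pos_iff.2 hmem
  simp; omega

theorem case_left (n k : ℕ) (hk1 : 1 ≤ k) (hk2 : k + 1 ≤ n) : ∀ (m : ℕ) (w : Equiv.Perm ℕ),
    IsPermOf n w → len n w = m → (∃ i1 i2 i3, 1 ≤ i1 ∧ i1 < i2 ∧ i2 ≤ k ∧ k < i3 ∧ i3 ≤ n ∧
      w i3 < w i2 ∧ k < w i1) → ∃ L, IsReducedWord n w L ∧ 2 ≤ L.count k := by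
  intro m
  induction m with
  | zero =>
    rintro w hw hm ⟨i1, i2, i3, h1, h12, h2k, hk3, h3, hlt, -⟩
    exfalso
    unfold len at hm
    rw [Finset.card_eq_zero, Finset.filter_eq_empty_iff] at hm
    exact hm (x := (i2, i3)) (by simp; omega) (by simp; omega)
  | succ m ih =>
    rintro w hw hm ⟨i1, i2, i3, h1, h12, h2k, hk3, h3, hlt, hbig⟩
    by_cases hdesc : ∃ i, ((i1 < i ∧ i < k) ∨ (k < i ∧ i < n)) ∧ w (i + 1) < w i
    · obtain ⟨i, hi, hd⟩ := hdesc
      have hs := len_step n w i (by omega) (by omega) hd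
      obtain ⟨L, hL, hc⟩ := ih (w * simpleRefl i) (perm_step n w hw i (by omega) (by omega))
        (by omega) ⟨simpleRefl i i1, simpleRefl i i2, simpleRefl i i3, by
          simp only [Equiv.Perm.mul_apply, sr_invol]
          refine ⟨?_, ?_, ?_, ?_, ?_, hlt, hbig⟩ <;> simp only [sr_apply] <;> split_ifs <;> omega⟩
      refine ⟨_, word_step n w i (by omega) (by omega) hd L hL, ?_⟩
      rw [List.count_append]; omega
    · push Not at hdesc
      have ha := inc_le w i2 k h2k fun i a b => hdesc i (by omega)
      have hb := inc_le w (k + 1) i3 hk3 fun i a b => hdesc i (by omega)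
      exact final_step n k w hw hk1 hk2 (by omega) i1 (by omega) (by omega) (by omega)

theorem case_right (n k : ℕ) (hk1 : 1 ≤ k) (hk2 : k + 1 ≤ n) : ∀ (m : ℕ) (w : Equiv.Perm ℕ),
    IsPermOf n w → len n w = m → (∃ i1 i2 i3, 1 ≤ i1 ∧ i1 ≤ k ∧ k < i2 ∧ i2 < i3 ∧ i3 ≤ n ∧
      w i2 < w i1 ∧ w i3 ≤ k) → ∃ L, IsReducedWord n w L ∧ 2 ≤ L.count k := by
  intro m
  induction m with
  | zero =>
    rintro w hw hm ⟨i1, i2, i3, h1, h12, h2k, hk3, h3, hlt, -⟩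
    exfalso
    unfold len at hm
    rw [Finset.card_eq_zero, Finset.filter_eq_empty_iff] at hm
    exact hm (x := (i1, i2)) (by simp; omega) (by simp; omega)
  | succ m ih =>
    rintro w hw hm ⟨i1, i2, i3, h1, h1k, hk2', h23, h3, hlt, hsm⟩
    by_cases hdesc : ∃ i, ((1 ≤ i ∧ i < k) ∨ (k < i ∧ i + 1 < i3)) ∧ w (i + 1) < w i
    · obtain ⟨i, hi, hd⟩ := hdesc
      have hs := len_step n w i (by omega) (by omega) hd
      obtain ⟨L, hL, hc⟩ := ih (w * simpleRefl i) (perm_step n w hw i (by omega) (by omega))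
        (by omega) ⟨simpleRefl i i1, simpleRefl i i2, simpleRefl i i3, by
          simp only [Equiv.Perm.mul_apply, sr_invol]
          refine ⟨?_, ?_, ?_, ?_, ?_, hlt, hsm⟩ <;> simp only [sr_apply] <;> split_ifs <;> omega⟩
      refine ⟨_, word_step n w i (by omega) (by omega) hd L hL, ?_⟩
      rw [List.count_append]; omega
    · push Not at hdesc
      have ha := inc_le w i1 k h1k fun i a b => hdesc i (by omega)
      have hb := inc_le w (k + 1) i2 hk2' fun i a b => hdesc i (by omega)
      exact final_step n k w hw hk1 hk2 (by omega) i3 (by omega) (by omega) (by omega)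

/-- If `w` has a `321`-pattern straddling `k` in both position and
value, then `max_k(w) ≥ 2`. -/
theorem two_le_maxOcc_of_straddling_321 (n : ℕ) (hn : 2 ≤ n) (w : Equiv.Perm ℕ)
    (hw : IsPermOf n w) (k : ℕ) (hk1 : 1 ≤ k) (hk2 : k ≤ n - 1)
    (hpat : ∃ i1 i2 i3, Is321At n w i1 i2 i3 ∧ i1 ≤ k ∧ k < i3 ∧ w i3 ≤ k ∧ k < w i1) :
    2 ≤ maxOcc n k w := by
  have key : ∃ L, IsReducedWord n w L ∧ 2 ≤ L.count k := by
    obtain ⟨i1, i2, i3, ⟨h1, h12, h23, h3, hcb, hba⟩, h1k, hk3, hck, hka⟩ := hpat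
    by_cases h : i2 ≤ k
    · exact case_left n k hk1 (by omega) _ w hw rfl
        ⟨i1, i2, i3, h1, h12, h, hk3, h3, hcb, hka⟩
    · exact case_right n k hk1 (by omega) _ w hw rfl
        ⟨i1, i2, i3, h1, h1k, by omega, h23, h3, hba, hck⟩
  obtain ⟨L, hL, hc⟩ := key
  refine hc.trans (le_csSup ⟨len n w, ?_⟩ ⟨L, hL, rfl⟩)
  rintro m ⟨L', hL', rfl⟩
  rw [← hL'.2]
  exact List.count_le_length
end

section
/- Fix n ≥ 2, v ∈ S_n, and k ∈ {1,…,n−1}. If σ_k ∈ supp(v) and ℓ(vσ_k) = ℓ(v) + 1, then every position pair at k of v is also a position pair at k of vσ_k, and vσ_k has at least one position pair at k that is not a position pair at k of v; in particular PosPair_k(vσ_k) ≥ PosPair_k(v) + 1. -/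
theorem sr_left (k : ℕ) : simpleRefl k k = k + 1 := by simp [simpleRefl]

theorem sr_right (k : ℕ) : simpleRefl k (k + 1) = k := by simp [simpleRefl]

theorem sr_ne (k x : ℕ) (h1 : x ≠ k) (h2 : x ≠ k + 1) : simpleRefl k x = x := by
  simp [simpleRefl, Equiv.swap_apply_of_ne_of_ne h1 h2]

theorem sr_sr (k x : ℕ) : simpleRefl k (simpleRefl k x) = x := by simp [simpleRefl]

theorem sr_cases (k x : ℕ) : (x = k ∧ simpleRefl k x = k + 1) ∨
    (x = k + 1 ∧ simpleRefl k x = k) ∨ (x ≠ k ∧ x ≠ k + 1 ∧ simpleRefl k x = x) := by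
  by_cases h1 : x = k
  · subst h1; simp [sr_left]
  by_cases h2 : x = k + 1
  · subst h2; simp [sr_right]
  exact Or.inr (Or.inr ⟨h1, h2, sr_ne k x h1 h2⟩)

theorem mul_sr_sr (k : ℕ) (v : Equiv.Perm ℕ) : v * simpleRefl k * simpleRefl k = v := by
  ext x; simp [sr_sr]

theorem len_asc (n i : ℕ) (u : Equiv.Perm ℕ) (h1 : 1 ≤ i) (h2 : i + 1 ≤ n)
    (h : u i < u (i + 1)) : len n (u * simpleRefl i) = len n u + 1 := by
  unfold len
  set S := (Finset.Icc 1 n ×ˢ Finset.Icc 1 n).filter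
    (fun p : ℕ × ℕ => p.1 < p.2 ∧ u p.2 < u p.1) with hS
  let e : ℕ × ℕ ↪ ℕ × ℕ := ⟨fun p => (simpleRefl i p.1, simpleRefl i p.2), by
    rintro ⟨a, b⟩ ⟨c, d⟩ hh
    simpa using hh⟩
  have hni : (i, i + 1) ∉ S.map e := by
    simp only [Finset.mem_map, hS, Finset.mem_filter, not_exists]
    rintro ⟨a, b⟩ ⟨⟨_, hab, _⟩, he⟩
    have e1 : simpleRefl i a = i := congrArg Prod.fst he
    have e2 : simpleRefl i b = i + 1 := congrArg Prod.snd he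
    have := sr_cases i a
    have := sr_cases i b
    simp only at hab
    omega
  rw [← Finset.card_map (s := S) e, ← Finset.card_insert_of_notMem hni]
  congr 1
  ext ⟨a, b⟩
  simp only [Finset.mem_filter, Finset.mem_insert, Finset.mem_map, hS, Finset.mem_product,
    Finset.mem_Icc, Prod.mk.injEq]
  simp only [Equiv.Perm.mul_apply]
  constructor
  · rintro ⟨⟨⟨ha1, ha2⟩, hb1, hb2⟩, hab, hu⟩
    by_cases hh : a = i ∧ b = i + 1
    · exact Or.inl hh
    · refine Or.inr ⟨(simpleRefl i a, simpleRefl i b), ⟨?_, ?_, hu⟩, ?_⟩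
      · have := sr_cases i a
        have := sr_cases i b
        dsimp only
        omega
      · have := sr_cases i a
        have := sr_cases i b
        dsimp only
        omega
      · exact Prod.ext (sr_sr i a) (sr_sr i b)
  · rintro (⟨rfl, rfl⟩ | ⟨⟨c, d⟩, ⟨hr, hcd, hu⟩, he⟩)
    · rw [sr_left, sr_right]
      exact ⟨by omega, by omega, h⟩
    · have e1 : simpleRefl i c = a := congrArg Prod.fst he
      have e2 : simpleRefl i d = b := congrArg Prod.snd he
      subst e1 e2
      rw [sr_sr, sr_sr]
      dsimp only at hr hcd hu
      have hne : ¬ (c = i ∧ d = i + 1) := by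
        rintro ⟨rfl, rfl⟩; omega
      have := sr_cases i c
      have := sr_cases i d
      exact ⟨by omega, by omega, hu⟩

theorem len_desc (n i : ℕ) (u : Equiv.Perm ℕ) (h1 : 1 ≤ i) (h2 : i + 1 ≤ n)
    (h : u (i + 1) < u i) : len n (u * simpleRefl i) + 1 = len n u := by
  have := len_asc n i (u * simpleRefl i) h1 h2 (by simpa [sr_left, sr_right] using h)
  rw [mul_sr_sr] at this
  exact this.symm

theorem asc_or (i : ℕ) (u : Equiv.Perm ℕ) : u i < u (i + 1) ∨ u (i + 1) < u i := by
  apply lt_or_gt_of_ne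
  intro h
  have := u.injective h
  omega

theorem len_le_succ (n i : ℕ) (u : Equiv.Perm ℕ) (h1 : 1 ≤ i) (h2 : i + 1 ≤ n) :
    len n (u * simpleRefl i) ≤ len n u + 1 := by
  rcases asc_or i u with h | h
  · exact (len_asc n i u h1 h2 h).le
  · have := len_desc n i u h1 h2 h
    omega

theorem asc_of_len (n i : ℕ) (u : Equiv.Perm ℕ) (h1 : 1 ≤ i) (h2 : i + 1 ≤ n)
    (hl : len n (u * simpleRefl i) = len n u + 1) : u i < u (i + 1) := by
  rcases asc_or i u with h | h
  · exact h
  · have := len_desc n i u h1 h2 h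
    omega

theorem len_word_le (n : ℕ) (hn : 2 ≤ n) (L : List ℕ) :
    (∀ i ∈ L, 1 ≤ i ∧ i ≤ n - 1) → len n (L.map simpleRefl).prod ≤ L.length := by
  induction L using List.reverseRecOn with
  | nil =>
    intro _
    have : len n (1 : Equiv.Perm ℕ) = 0 := by
      unfold len
      rw [Finset.card_eq_zero, Finset.filter_eq_empty_iff]
      rintro ⟨a, b⟩ _
      simp only [Equiv.Perm.one_apply]
      omega
    simp [this]
  | append_singleton L i ih =>
    intro h
    have hi := h i (by simp)
    have h' := ih (fun j hj => h j (by simp [hj]))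
    have := len_le_succ n i (L.map simpleRefl).prod hi.1 (by omega)
    simp only [List.map_append, List.prod_append, List.map_cons, List.map_nil,
      List.prod_singleton, List.length_append, List.length_singleton]
    omega

theorem crossing (n : ℕ) (hn : 2 ≤ n) (k : ℕ) (L : List ℕ) :
    (∀ i ∈ L, 1 ≤ i ∧ i ≤ n - 1) → L.length = len n (L.map simpleRefl).prod → k ∈ L →
    ∃ x y, 1 ≤ x ∧ x ≤ k ∧ k < y ∧ y ≤ n ∧
      (L.map simpleRefl).prod y < (L.map simpleRefl).prod x := by
  induction L using List.reverseRecOn with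
  | nil => intro _ _ h; simp at h
  | append_singleton L i ih =>
    intro h hl hk
    have hi := h i (by simp)
    have hL : ∀ j ∈ L, 1 ≤ j ∧ j ≤ n - 1 := fun j hj => h j (by simp [hj])
    have h2 := len_word_le n hn L hL
    simp only [List.map_append, List.prod_append, List.map_cons, List.map_nil,
      List.prod_singleton, List.length_append, List.length_singleton] at hl ⊢
    set u := (L.map simpleRefl).prod with hu
    have h1 := len_le_succ n i u hi.1 (by omega)
    by_cases hik : i = k
    · subst hik
      have := asc_of_len n i u hi.1 (by omega) (by omega)
      exact ⟨i, i + 1, by omega, by omega, by omega, by omega, by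
        simpa [sr_left, sr_right] using this⟩
    · have hkL : k ∈ L := by
        simp only [List.mem_append, List.mem_singleton] at hk
        rcases hk with hk | hk
        · exact hk
        · exact absurd hk.symm hik
      obtain ⟨x, y, a1, a2, a3, a4, a5⟩ := ih hL (by omega) hkL
      have c1 := sr_cases i x
      have c2 := sr_cases i y
      refine ⟨simpleRefl i x, simpleRefl i y, by omega, by omega, by omega, by omega, ?_⟩
      simpa [sr_sr] using a5

theorem exists_new (n : ℕ) (v w : Equiv.Perm ℕ) (k : ℕ) (hk1 : 1 ≤ k) (hk2 : k + 1 ≤ n)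
    (hasc : v k < v (k + 1)) (wk : w k = v (k + 1)) (wk1 : w (k + 1) = v k)
    (wo : ∀ x, x ≠ k → x ≠ k + 1 → w x = v x)
    (hc : ∃ x y, 1 ≤ x ∧ x ≤ k ∧ k < y ∧ y ≤ n ∧ v y < v x) :
    ∃ p : ℕ × ℕ, IsPosPair n k w p ∧ ¬ IsPosPair n k v p := by
  by_cases hA : ∃ q, k + 1 < q ∧ q ≤ n ∧ v q < v k
  · obtain ⟨q, hq, hmax⟩ := Finset.exists_max_image
      ((Finset.Icc (k + 2) n).filter fun q => v q < v k) v (by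
        obtain ⟨q, h1, h2, h3⟩ := hA
        exact ⟨q, by simp; omega⟩)
    simp only [Finset.mem_filter, Finset.mem_Icc] at hq hmax
    refine ⟨(k, q), Or.inl ⟨k + 1, ⟨hk1, by simp, by simp; omega, hq.1.2, ?_, ?_⟩, le_refl _,
      by simp; omega⟩, ?_⟩
    · rw [wk1, wo q (by omega) (by omega)]; exact hq.2
    · simp only [wk1, wk]; exact hasc
    · rintro (⟨m, ⟨h1, h2, h3, h4, h5, h6⟩, -⟩ | ⟨i, j, ⟨h1, h2, h3, h4, h5, h6, h7, h8⟩, -⟩)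
      · dsimp only at *
        have : m ≠ k + 1 := by rintro rfl; omega
        have := hmax m (by omega)
        omega
      · dsimp only at *
        have := hmax j (by omega)
        omega
  by_cases hB : ∃ p, 1 ≤ p ∧ p < k ∧ v (k + 1) < v p
  · obtain ⟨q, hq, hmin⟩ := Finset.exists_min_image
      ((Finset.Ico 1 k).filter fun q => v (k + 1) < v q) v (by
        obtain ⟨q, h1, h2, h3⟩ := hB
        exact ⟨q, by simp; omega⟩)
    simp only [Finset.mem_filter, Finset.mem_Ico] at hq hmin
    refine ⟨(q, k + 1), Or.inl ⟨k, ⟨hq.1.1, hq.1.2, by simp, hk2, ?_, ?_⟩, hq.1.2.le,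
      by simp⟩, ?_⟩
    · simp only [wk1, wk]; exact hasc
    · rw [wk, wo q (by omega) (by omega)]; exact hq.2
    · rintro (⟨m, ⟨h1, h2, h3, h4, h5, h6⟩, -⟩ | ⟨i, j, ⟨h1, h2, h3, h4, h5, h6, h7, h8⟩, -⟩)
      · dsimp only at *
        have : m ≠ k := by rintro rfl; omega
        have := hmin m (by omega)
        omega
      · dsimp only at *
        have := hmin i (by omega)
        omega
  · push Not at hA hB
    obtain ⟨x, y, h1, h2, h3, h4, h5⟩ := hc
    have inj : ∀ a b, a ≠ b → v a ≠ v b := fun a b h h' => h (v.injective h')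
    have hx : x ≠ k := by
      rintro rfl
      have : y ≠ x + 1 := by rintro rfl; omega
      have := hA y (by omega) h4
      omega
    have hy : y ≠ k + 1 := by
      rintro rfl
      have := hB x h1 (by omega)
      omega
    have a1 := hA y (by omega) h4
    have a2 := hB x h1 (by omega)
    have a3 := inj y k (by omega)
    have a4 := inj x (k + 1) (by omega)
    refine ⟨(k, k + 1), Or.inr ⟨x, y, ⟨h1, by simp; omega, by simp, by simp; omega, h4, ?_, ?_, ?_⟩,
      le_refl _, by simp⟩, ?_⟩
    · simp only [wk1]; rw [wo y (by omega) hy]; omega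
    · rw [wo y (by omega) hy, wo x hx (by omega)]; exact h5
    · simp only [wk]; rw [wo x hx (by omega)]; omega
    · rintro (⟨m, ⟨h1, h2, h3, h4, h5, h6⟩, -⟩ | ⟨i, j, ⟨h1, h2, h3, h4, h5, h6, h7, h8⟩, -⟩)
      · dsimp only at *; omega
      · dsimp only at *; omega

theorem pair_mono (n : ℕ) (v w : Equiv.Perm ℕ) (k : ℕ)
    (hasc : v k < v (k + 1)) (wk : w k = v (k + 1)) (wk1 : w (k + 1) = v k)
    (wo : ∀ x, x ≠ k → x ≠ k + 1 → w x = v x) (p : ℕ × ℕ) (hp : IsPosPair n k v p) :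
    IsPosPair n k w p := by
  obtain ⟨p, q⟩ := p
  have up : ∀ x, x ≤ k → v x ≤ w x := by
    intro x hx
    by_cases h : x = k
    · subst h; omega
    · rw [wo x h (by omega)]
  have dn : ∀ x, k < x → w x ≤ v x := by
    intro x hx
    by_cases h : x = k + 1
    · subst h; omega
    · rw [wo x (by omega) h]
  rcases hp with ⟨m, ⟨h1, h2, h3, h4, h5, h6⟩, h7, h8⟩ |
    ⟨i, j, ⟨h1, h2, h3, h4, h5, h6, h7, h8⟩, h9, h10⟩
  · dsimp only at *
    have u1 := up p h7
    have u2 := dn q h8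
    by_cases m1 : m = k
    · subst m1
      have : q ≠ m + 1 := by rintro rfl; omega
      exact Or.inl ⟨m + 1, ⟨h1, by dsimp only; omega, by dsimp only; omega, h4,
        by dsimp only; omega, by dsimp only; omega⟩, h7, h8⟩
    by_cases m2 : m = k + 1
    · subst m2
      have : p ≠ k := by rintro rfl; omega
      exact Or.inl ⟨k, ⟨h1, by dsimp only; omega, by dsimp only; omega, h4,
        by dsimp only; omega, by dsimp only; omega⟩, h7, h8⟩
    have := wo m m1 m2
    exact Or.inl ⟨m, ⟨h1, h2, h3, h4, by dsimp only; omega, by dsimp only; omega⟩, h7, h8⟩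
  · dsimp only at *
    have u1 := up p h9
    have u2 := dn q h10
    have u3 := wo i (by omega) (by omega)
    have u4 := wo j (by omega) (by omega)
    exact Or.inr ⟨i, j, ⟨h1, h2, h3, h4, h5, by dsimp only; omega, by omega,
      by dsimp only; omega⟩, h9, h10⟩

/-- If `σ_k ∈ supp(v)` and `ℓ(vσ_k) = ℓ(v) + 1`, then every position
pair at `k` of `v` is a position pair at `k` of `vσ_k`, and `vσ_k` has a position pair
at `k` that `v` does not have; in particular `PosPair_k(vσ_k) ≥ PosPair_k(v) + 1`. -/
theorem posPair_increases_mul_same (n : ℕ) (hn : 2 ≤ n) (v : Equiv.Perm ℕ)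
    (hv : IsPermOf n v) (k : ℕ) (hk1 : 1 ≤ k) (hk2 : k ≤ n - 1)
    (hsupp : ∃ L : List ℕ, IsReducedWord n v L ∧ k ∈ L)
    (hlen : len n (v * simpleRefl k) = len n v + 1) :
    (∀ p : ℕ × ℕ, IsPosPair n k v p → IsPosPair n k (v * simpleRefl k) p) ∧
    (∃ p : ℕ × ℕ, IsPosPair n k (v * simpleRefl k) p ∧ ¬ IsPosPair n k v p) ∧
    posPairCount n k v + 1 ≤ posPairCount n k (v * simpleRefl k) := by

  have hk3 : k + 1 ≤ n := by omega
  have hasc := asc_of_len n k v hk1 hk3 hlen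
  have wk : (v * simpleRefl k) k = v (k + 1) := by simp [sr_left]
  have wk1 : (v * simpleRefl k) (k + 1) = v k := by simp [sr_right]
  have wo : ∀ x, x ≠ k → x ≠ k + 1 → (v * simpleRefl k) x = v x := by
    intro x h1 h2
    simp [sr_ne k x h1 h2]
  have hc : ∃ x y, 1 ≤ x ∧ x ≤ k ∧ k < y ∧ y ≤ n ∧ v y < v x := by
    obtain ⟨L, ⟨⟨hL, rfl⟩, hl⟩, hk⟩ := hsupp
    exact crossing n hn k L hL hl hk
  have P1 := pair_mono n v (v * simpleRefl k) k hasc wk wk1 wo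
  have P2 := exists_new n v (v * simpleRefl k) k hk1 hk3 hasc wk wk1 wo hc
  refine ⟨P1, P2, ?_⟩
  obtain ⟨p, hp1, hp2⟩ := P2
  unfold posPairCount
  rw [Nat.add_one_le_iff]
  apply Set.ncard_lt_ncard
  · exact ⟨P1, fun h => hp2 (h hp1)⟩
  · apply Set.Finite.subset (Finset.finite_toSet (Finset.Icc 1 n ×ˢ Finset.Icc 1 n))
    rintro ⟨a, b⟩ (⟨m, ⟨h1, h2, h3, h4, -⟩, -⟩ | ⟨i, j, ⟨h1, h2, h3, h4, h5, -⟩, -⟩)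
    · simp only [Finset.coe_product, Set.mem_prod, Finset.coe_Icc, Set.mem_Icc]
      dsimp only at *
      omega
    · simp only [Finset.coe_product, Set.mem_prod, Finset.coe_Icc, Set.mem_Icc]
      dsimp only at *
      omega
end
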